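/- arXiv:2605.14320 — 4 statements merged into one kernel-verified Lean document; each statement's English description precedes it below -/
import Mathlib

section
/- Let q, n ≥ 1, X ⊆ ℝ^n nonempty, Γ : X → ℝ^q a map, C ⊆ ℝ^q a convex cone containing 0, w̄ ∈ ℝ^q, γ ∈ ℝ, and let A := {Γ(x) + c : x ∈ X, c ∈ C} ∩ {y ∈ ℝ^q : w̄ᵀy ≤ γ}. Let w* ∈ C⁺, λ* ≥ 0, x* ∈ X, c* ∈ C, and set y* := Γ(x*) + c*. Assume: (a) x* minimizes w*ᵀΓ over X, i.e. w*ᵀΓ(x*) ≤ w*ᵀΓ(x) for all x ∈ X; (b) complementary slackness w*ᵀc* = 0; and (c) complementary slackness λ*(w̄ᵀy* − γ) = 0. Then, with g* := w* − λ*w̄, one has g*ᵀy ≥ g*ᵀy* for every y ∈ A; that is, the halfspace {y ∈ ℝ^q : g*ᵀy ≥ g*ᵀy*} contains A. -/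
open Matrix Set

/-- The dual cone of a set `C ⊆ ℝ^q`: `C⁺ = {u : uᵀy ≥ 0 for all y ∈ C}`. -/
def dualCone' {q : ℕ} (C : Set (Fin q → ℝ)) : Set (Fin q → ℝ) :=
  {u | ∀ y ∈ C, 0 ≤ u ⬝ᵥ y}

/-- the halfspace generated from a dual optimal pair supports the slice
`A = (Γ(X) + C) ∩ {y : w̄ᵀy ≤ γ}`: under minimality of `x*` for `w*ᵀΓ` and the two
complementary slackness conditions, `g*ᵀy ≥ g*ᵀy*` for all `y ∈ A`, where
`g* = w* − λ*w̄` and `y* = Γ(x*) + c*`. -/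
theorem stmt3 {q n : ℕ} (hq : 1 ≤ q) (hn : 1 ≤ n)
    (X : Set (Fin n → ℝ)) (hX : X.Nonempty)
    (Γ : (Fin n → ℝ) → (Fin q → ℝ))
    (C : Set (Fin q → ℝ)) (hCconv : Convex ℝ C)
    (hCcone : ∀ (t : ℝ), 0 ≤ t → ∀ y ∈ C, t • y ∈ C) (h0C : (0 : Fin q → ℝ) ∈ C)
    (wbar : Fin q → ℝ) (γ : ℝ)
    (A : Set (Fin q → ℝ))
    (hA : A = {y | ∃ x ∈ X, ∃ c ∈ C, y = Γ x + c} ∩ {y | wbar ⬝ᵥ y ≤ γ})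
    (wstar : Fin q → ℝ) (hw : wstar ∈ dualCone' C)
    (lamstar : ℝ) (hlam : 0 ≤ lamstar)
    (xstar : Fin n → ℝ) (hx : xstar ∈ X)
    (cstar : Fin q → ℝ) (hc : cstar ∈ C)
    (ystar : Fin q → ℝ) (hy : ystar = Γ xstar + cstar)
    (hmin : ∀ x ∈ X, wstar ⬝ᵥ Γ xstar ≤ wstar ⬝ᵥ Γ x)
    (hcs1 : wstar ⬝ᵥ cstar = 0)
    (hcs2 : lamstar * (wbar ⬝ᵥ ystar - γ) = 0) :
    ∀ y ∈ A, (wstar - lamstar • wbar) ⬝ᵥ ystar ≤ (wstar - lamstar • wbar) ⬝ᵥ y := by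
  subst hA hy
  rintro y ⟨⟨x, hxX, c, hcC, rfl⟩, hyγ⟩
  have hΓ := hmin x hxX
  have hwc : 0 ≤ wstar ⬝ᵥ c := hw c hcC
  have hslack : lamstar * (wbar ⬝ᵥ (Γ x + c)) ≤ lamstar * γ :=
    mul_le_mul_of_nonneg_left hyγ hlam
  simp only [sub_dotProduct, smul_dotProduct, smul_eq_mul, dotProduct_add] at *
  linarith
end

section
/- Let q ≥ 1, ε₀ > 0, ε ≥ 0. Let A ⊆ ℝ^q be nonempty and convex, Q ⊆ ℝ^q nonempty, compact and convex with A ⊆ Q, and let M ∈ ℝ^{q×q} be symmetric positive definite with ε₀ I ⪯ M in the Loewner order. If every extreme point v of Q satisfies d_M(v,A) ≤ √ε₀ · ε, then δ_H(Q,A;‖·‖_2) ≤ ε; that is, Q is a Euclidean ε-outer approximation of A. -/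
open Matrix Set
open scoped ENNReal

/-- The norm induced by a symmetric positive definite matrix `M`. -/
noncomputable def mnorm {q : ℕ} (M : Matrix (Fin q) (Fin q) ℝ) (y : Fin q → ℝ) : ℝ :=
  Real.sqrt (y ⬝ᵥ M.mulVec y)

/-- The Euclidean norm on `Fin q → ℝ`. -/
noncomputable def enorm2 {q : ℕ} (y : Fin q → ℝ) : ℝ :=
  Real.sqrt (y ⬝ᵥ y)

/-- Hausdorff distance (valued in `[0,∞]`) of two sets with respect to a given norm. -/
noncomputable def hdistN {q : ℕ} (nrm : (Fin q → ℝ) → ℝ) (A B : Set (Fin q → ℝ)) : ℝ≥0∞ :=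
  max (⨆ a ∈ A, ⨅ b ∈ B, ENNReal.ofReal (nrm (a - b)))
      (⨆ b ∈ B, ⨅ a ∈ A, ENNReal.ofReal (nrm (a - b)))

/-- Distance from a point to a set in the `M`-norm. -/
noncomputable def dM {q : ℕ} (M : Matrix (Fin q) (Fin q) ℝ) (v : Fin q → ℝ)
    (S : Set (Fin q → ℝ)) : ℝ :=
  sInf ((fun y => mnorm M (v - y)) '' S)

lemma enorm2_eq_norm {q : ℕ} (y : Fin q → ℝ) :
    enorm2 y = ‖(WithLp.linearEquiv 2 ℝ (Fin q → ℝ)).symm y‖ := by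
  simp [enorm2, EuclideanSpace.norm_eq, dotProduct, sq]

lemma enorm2_add_le {q : ℕ} (x y : Fin q → ℝ) : enorm2 (x + y) ≤ enorm2 x + enorm2 y := by
  simp only [enorm2_eq_norm, map_add]
  exact norm_add_le _ _

lemma continuous_enorm2 {q : ℕ} : Continuous (enorm2 : (Fin q → ℝ) → ℝ) := by
  unfold enorm2 dotProduct
  fun_prop

lemma convex_enorm2_lt {q : ℕ} (r : ℝ) : Convex ℝ {y : Fin q → ℝ | enorm2 y < r} := by
  have hset : {y : Fin q → ℝ | enorm2 y < r} =
      (WithLp.linearEquiv 2 ℝ (Fin q → ℝ)).symm.toLinearMap ⁻¹' Metric.ball 0 r := by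
    ext y
    simp [enorm2_eq_norm]
  rw [hset]
  exact (convex_ball _ r).linear_preimage _

lemma sqrt_mul_enorm2_le_mnorm {q : ℕ} {ε₀ : ℝ} (hε₀ : 0 ≤ ε₀)
    {M : Matrix (Fin q) (Fin q) ℝ}
    (hM : (M - ε₀ • (1 : Matrix (Fin q) (Fin q) ℝ)).PosSemidef) (y : Fin q → ℝ) :
    Real.sqrt ε₀ * enorm2 y ≤ mnorm M y := by
  rw [enorm2, mnorm, ← Real.sqrt_mul hε₀]
  refine Real.sqrt_le_sqrt ?_
  have h := hM.dotProduct_mulVec_nonneg y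
  simp only [star_trivial, sub_mulVec, smul_mulVec, one_mulVec, dotProduct_sub,
    dotProduct_smul, smul_eq_mul] at h
  linarith

/-- A near-minimizer for the `M`-distance is a near-minimizer for the scaled Euclidean distance. -/
lemma exists_enorm2_sub_lt_of_dM_le {q : ℕ} {ε₀ ε r : ℝ} (hε₀ : 0 < ε₀)
    {M : Matrix (Fin q) (Fin q) ℝ}
    (hM : (M - ε₀ • (1 : Matrix (Fin q) (Fin q) ℝ)).PosSemidef)
    {A : Set (Fin q → ℝ)} (hA : A.Nonempty) {v : Fin q → ℝ}
    (hv : dM M v A ≤ Real.sqrt ε₀ * ε) (hr : ε < r) :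
    ∃ a ∈ A, enorm2 (v - a) < r := by
  have hs : 0 < Real.sqrt ε₀ := Real.sqrt_pos.2 hε₀
  obtain ⟨_, ⟨a, ha, rfl⟩, hlt⟩ := exists_lt_of_csInf_lt (hA.image _)
    (hv.trans_lt (mul_lt_mul_of_pos_left hr hs))
  exact ⟨a, ha, lt_of_mul_lt_mul_left
    ((sqrt_mul_enorm2_le_mnorm hε₀.le hM _).trans_lt hlt) hs.le⟩

open scoped Pointwise in
/-- If the extreme points of a compact convex set are within Euclidean distance less than `r` of
a convex set, then every point of the set is within distance less than any `s > r`. -/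
lemma exists_enorm2_sub_lt_of_extremePoints {q : ℕ} {r s : ℝ} {A Q : Set (Fin q → ℝ)}
    (hA : Convex ℝ A) (hQcomp : IsCompact Q) (hQ : Convex ℝ Q)
    (hext : ∀ v ∈ Set.extremePoints ℝ Q, ∃ a ∈ A, enorm2 (v - a) < r) (hrs : r < s)
    {x : Fin q → ℝ} (hx : x ∈ Q) : ∃ a ∈ A, enorm2 (x - a) < s := by
  have hconv := hA.add (convex_enorm2_lt (q := q) r)
  have hsub : convexHull ℝ (Set.extremePoints ℝ Q) ⊆ A + {y | enorm2 y < r} := by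
    refine convexHull_min (fun v hv => ?_) hconv
    obtain ⟨a, ha, hlt⟩ := hext v hv
    exact ⟨a, ha, v - a, hlt, add_sub_cancel a v⟩
  rw [← closure_convexHull_extremePoints hQcomp hQ] at hx
  have hopen : IsOpen {y | enorm2 (x - y) < s - r} :=
    isOpen_lt (continuous_enorm2.comp (continuous_const.sub continuous_id)) continuous_const
  have hmem : x ∈ {y | enorm2 (x - y) < s - r} := by simpa [enorm2] using hrs
  obtain ⟨y, hy, hyc⟩ := mem_closure_iff.1 hx _ hopen hmem
  obtain ⟨a, ha, z, hz, rfl⟩ := hsub hyc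
  refine ⟨a, ha, ?_⟩
  have h := enorm2_add_le (x - (a + z)) z
  rw [show x - (a + z) + z = x - a by abel] at h
  simp only [mem_ofPred_eq] at hy hz
  linarith

/-- sufficient computable stopping test.  If `ε₀I ⪯ M` and every extreme
point `v` of the compact convex outer set `Q ⊇ A` satisfies `d_M(v,A) ≤ √ε₀·ε`, then
`δ_H(Q,A;‖·‖₂) ≤ ε`, i.e. `Q` is a Euclidean `ε`-outer approximation of `A`. -/
theorem stmt12 {q : ℕ} (hq : 1 ≤ q) (ε₀ ε : ℝ) (hε₀ : 0 < ε₀) (hε : 0 ≤ ε)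
    (A Q : Set (Fin q → ℝ))
    (hAne : A.Nonempty) (hAconv : Convex ℝ A)
    (hQne : Q.Nonempty) (hQcomp : IsCompact Q) (hQconv : Convex ℝ Q)
    (hAQ : A ⊆ Q)
    (M : Matrix (Fin q) (Fin q) ℝ) (hM : M.PosDef)
    (hLoew : (M - ε₀ • (1 : Matrix (Fin q) (Fin q) ℝ)).PosSemidef)
    (hext : ∀ v ∈ Set.extremePoints ℝ Q, dM M v A ≤ Real.sqrt ε₀ * ε) :
    hdistN enorm2 Q A ≤ ENNReal.ofReal ε := by
  refine max_le (iSup₂_le fun x hx => ENNReal.le_of_forall_pos_le_add fun δ hδ _ => ?_)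
    (iSup₂_le fun b hb => iInf₂_le_of_le b (hAQ hb) (by simp [enorm2]))
  have hδ' : (0 : ℝ) < δ := hδ
  obtain ⟨a, ha, hlt⟩ := exists_enorm2_sub_lt_of_extremePoints (r := ε + δ / 2) (s := ε + δ)
    hAconv hQcomp hQconv
    (fun v hv => exists_enorm2_sub_lt_of_dM_le hε₀ hLoew hAne (hext v hv) (by linarith))
    (by linarith) hx
  refine iInf₂_le_of_le a ha ?_
  rw [← ENNReal.ofReal_coe_nnreal, ← ENNReal.ofReal_add hε hδ'.le]
  exact ENNReal.ofReal_le_ofReal hlt.le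
end

section
/- Let q ≥ 1 and let A ⊆ ℝ^q be nonempty, compact and convex. Let (P_k)_{k≥0} be a sequence of nonempty compact convex subsets of ℝ^q with A ⊆ P_{k+1} ⊆ P_k for all k. Let 0 < m ≤ M′ and let (M_k)_{k≥0} be symmetric positive definite matrices with m I ⪯ M_k ⪯ M′ I in the Loewner order for all k. Suppose that for each k there exist v_k ∈ P_k and y_k ∈ A such that: (a) d_{M_k}(v_k, A) = sup_{v ∈ P_k} d_{M_k}(v, A); (b) ‖v_k − y_k‖_{M_k} = d_{M_k}(v_k, A); and (c) P_{k+1} ⊆ {y ∈ ℝ^q : g_kᵀ y ≥ g_kᵀ y_k}, where g_k := M_k (y_k − v_k). Then the Euclidean Hausdorff error converges to zero: δ_H(P_k, A; ‖·‖_2) → 0 as k → ∞. -/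
open Matrix Set
open scoped ENNReal

section

variable {q : ℕ} {M : Matrix (Fin q) (Fin q) ℝ}

theorem continuous_mnorm_sub (M : Matrix (Fin q) (Fin q) ℝ) (w : Fin q → ℝ) :
    Continuous fun y => mnorm M (w - y) := by
  unfold mnorm
  fun_prop

theorem continuous_mnorm_sub_right (M : Matrix (Fin q) (Fin q) ℝ) (a : Fin q → ℝ) :
    Continuous fun y => mnorm M (y - a) := by
  unfold mnorm
  fun_prop

theorem mnorm_nonneg (M : Matrix (Fin q) (Fin q) ℝ) (y : Fin q → ℝ) : 0 ≤ mnorm M y :=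
  Real.sqrt_nonneg _

theorem dM_le_mnorm (M : Matrix (Fin q) (Fin q) ℝ) {S : Set (Fin q → ℝ)} (w : Fin q → ℝ)
    {a : Fin q → ℝ} (ha : a ∈ S) : dM M w S ≤ mnorm M (w - a) :=
  csInf_le ⟨0, by rintro _ ⟨b, -, rfl⟩; exact mnorm_nonneg _ _⟩ ⟨a, ha, rfl⟩

/-- The `M`-distance to a nonempty compact set is attained. -/
theorem exists_mnorm_le_dM (M : Matrix (Fin q) (Fin q) ℝ) {S : Set (Fin q → ℝ)}
    (hne : S.Nonempty) (hS : IsCompact S) (w : Fin q → ℝ) :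
    ∃ b ∈ S, mnorm M (w - b) ≤ dM M w S := by
  obtain ⟨b, hb, hmin⟩ := hS.exists_isMinOn hne (continuous_mnorm_sub M w).continuousOn
  refine ⟨b, hb, le_csInf (hne.image _) ?_⟩
  rintro _ ⟨c, hc, rfl⟩
  exact hmin hc

theorem bddAbove_dM_image (M : Matrix (Fin q) (Fin q) ℝ) {S T : Set (Fin q → ℝ)}
    (hne : S.Nonempty) (hT : IsCompact T) : BddAbove ((fun w => dM M w S) '' T) := by
  obtain ⟨a, ha⟩ := hne
  obtain ⟨C, hC⟩ := hT.bddAbove_image (continuous_mnorm_sub_right M a).continuousOn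
  refine ⟨C, ?_⟩
  rintro _ ⟨w, hw, rfl⟩
  exact (dM_le_mnorm M w ha).trans (hC ⟨w, hw, rfl⟩)

theorem dotProduct_mulVec_nonneg (hM : M.PosSemidef) (x : Fin q → ℝ) : 0 ≤ x ⬝ᵥ M *ᵥ x := by
  simpa using hM.dotProduct_mulVec_nonneg x

theorem smul_dotProduct_le {m : ℝ} (h : (M - m • (1 : Matrix (Fin q) (Fin q) ℝ)).PosSemidef)
    (x : Fin q → ℝ) : m * (x ⬝ᵥ x) ≤ x ⬝ᵥ M *ᵥ x := by
  have := dotProduct_mulVec_nonneg h x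
  simp only [sub_mulVec, smul_mulVec, one_mulVec, dotProduct_sub, dotProduct_smul,
    smul_eq_mul] at this
  linarith

theorem dotProduct_mulVec_le {m : ℝ} (h : (m • (1 : Matrix (Fin q) (Fin q) ℝ) - M).PosSemidef)
    (x : Fin q → ℝ) : x ⬝ᵥ M *ᵥ x ≤ m * (x ⬝ᵥ x) := by
  have := dotProduct_mulVec_nonneg h x
  simp only [sub_mulVec, smul_mulVec, one_mulVec, dotProduct_sub, dotProduct_smul,
    smul_eq_mul] at this
  linarith

theorem enorm2_le_mnorm_div {m : ℝ} (hm : 0 < m)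
    (h : (M - m • (1 : Matrix (Fin q) (Fin q) ℝ)).PosSemidef) (x : Fin q → ℝ) :
    enorm2 x ≤ mnorm M x / √m := by
  rw [enorm2, mnorm, ← Real.sqrt_div' _ hm.le]
  apply Real.sqrt_le_sqrt
  rw [le_div_iff₀ hm, mul_comm]
  exact smul_dotProduct_le h x

/-- Every point `d` of the halfspace with normal `M u` through `u` is at least as long as `u` in
the `M`-norm. -/
theorem dotProduct_mulVec_le_of_halfspace (hM : M.PosSemidef) {u d : Fin q → ℝ}
    (h : M *ᵥ u ⬝ᵥ u ≤ M *ᵥ u ⬝ᵥ d) : u ⬝ᵥ M *ᵥ u ≤ d ⬝ᵥ M *ᵥ d := by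
  have hsymm : u ⬝ᵥ M *ᵥ d = M *ᵥ u ⬝ᵥ d := by
    have hT : Mᵀ = M := by simpa using hM.isHermitian.eq
    rw [dotProduct_mulVec, ← mulVec_transpose, hT]
  have h0 := dotProduct_mulVec_nonneg hM (u - d)
  simp only [mulVec_sub, dotProduct_sub, sub_dotProduct, hsymm] at h0
  rw [dotProduct_comm d (M *ᵥ u)] at h0
  rw [dotProduct_comm (M *ᵥ u) u] at h
  linarith

/-- Along a sequence in a compact set, a nonnegative quantity that bounds from below the pairwise
Euclidean separation of the terms tends to zero. -/
theorem tendsto_zero_of_le_separation {K : Set (Fin q → ℝ)} (hK : IsCompact K)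
    {v : ℕ → Fin q → ℝ} (hv : ∀ k, v k ∈ K) {s : ℕ → ℝ} (hs : ∀ k, 0 ≤ s k) (C : ℝ)
    (hsep : ∀ k j, k < j → s k ≤ C * ((v j - v k) ⬝ᵥ (v j - v k))) :
    Filter.Tendsto s Filter.atTop (nhds 0) := by
  by_contra hcon
  obtain ⟨ε, hε, hfreq⟩ : ∃ ε > 0, ∃ᶠ k in Filter.atTop, ε ≤ s k := by
    by_contra! hall
    refine hcon (Metric.tendsto_nhds.2 fun ε hε => ?_)
    filter_upwards [hall ε hε] with k hk
    rwa [Real.dist_0_eq_abs, abs_of_nonneg (hs k)]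
  obtain ⟨φ, hφ, hφs⟩ := Filter.extraction_of_frequently_atTop hfreq
  obtain ⟨a, -, ψ, hψ, hlim⟩ := hK.tendsto_subseq fun n => hv (φ n)
  have hdiff := (hlim.comp (Filter.tendsto_add_atTop_nat 1)).sub hlim
  have hcont : Continuous fun x : Fin q → ℝ => C * (x ⬝ᵥ x) := by fun_prop
  have hzero := (hcont.tendsto _).comp hdiff
  rw [sub_self, dotProduct_zero, mul_zero] at hzero
  refine hε.not_ge (ge_of_tendsto' hzero fun n => ?_)
  exact (hφs (ψ n)).trans (hsep _ _ (hφ (hψ n.lt_succ_self)))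

end

theorem hdistN_enorm2_le {q : ℕ} {P A : Set (Fin q → ℝ)} (hAP : A ⊆ P) {r : ℝ}
    (h : ∀ w ∈ P, ∃ b ∈ A, enorm2 (w - b) ≤ r) :
    hdistN enorm2 P A ≤ ENNReal.ofReal r := by
  refine max_le (iSup₂_le fun w hw => ?_) (iSup₂_le fun b hb => ?_)
  · obtain ⟨b, hb, hle⟩ := h w hw
    exact (iInf₂_le b hb).trans (ENNReal.ofReal_le_ofReal hle)
  · exact (iInf₂_le b (hAP hb)).trans (by simp [enorm2])

/-- Euclidean convergence of the adaptive-metric outer approximation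
scheme.  Under uniform spectral bounds `mI ⪯ M_k ⪯ M′I`, if at each iteration a
farthest vertex `v_k` in the `M_k`-metric is selected, `y_k ∈ A` is its `M_k`-nearest
point, and `P_{k+1}` lies in the supporting halfspace with normal
`g_k = M_k(y_k − v_k)`, then `δ_H(P_k, A; ‖·‖₂) → 0`. -/
theorem stmt16 {q : ℕ} (hq : 1 ≤ q)
    (A : Set (Fin q → ℝ)) (hAne : A.Nonempty) (hAcomp : IsCompact A) (hAconv : Convex ℝ A)
    (P : ℕ → Set (Fin q → ℝ))
    (hPne : ∀ k, (P k).Nonempty) (hPcomp : ∀ k, IsCompact (P k))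
    (hPconv : ∀ k, Convex ℝ (P k))
    (hAP : ∀ k, A ⊆ P k) (hnest : ∀ k, P (k + 1) ⊆ P k)
    (m M' : ℝ) (hm : 0 < m) (hmM : m ≤ M')
    (Mk : ℕ → Matrix (Fin q) (Fin q) ℝ) (hMkpd : ∀ k, (Mk k).PosDef)
    (hlow : ∀ k, (Mk k - m • (1 : Matrix (Fin q) (Fin q) ℝ)).PosSemidef)
    (hup : ∀ k, (M' • (1 : Matrix (Fin q) (Fin q) ℝ) - Mk k).PosSemidef)
    (v y : ℕ → (Fin q → ℝ))
    (hvP : ∀ k, v k ∈ P k) (hyA : ∀ k, y k ∈ A)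
    (ha : ∀ k, dM (Mk k) (v k) A = sSup ((fun w => dM (Mk k) w A) '' P k))
    (hb : ∀ k, mnorm (Mk k) (v k - y k) = dM (Mk k) (v k) A)
    (hc : ∀ k, P (k + 1) ⊆
      {w | (Mk k).mulVec (y k - v k) ⬝ᵥ y k ≤ (Mk k).mulVec (y k - v k) ⬝ᵥ w}) :
    Filter.Tendsto (fun k => hdistN enorm2 (P k) A) Filter.atTop (nhds 0) := by
  have hanti : Antitone P := antitone_nat_of_succ_le hnest
  have hsq : Filter.Tendsto (fun k => (v k - y k) ⬝ᵥ Mk k *ᵥ (v k - y k))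
      Filter.atTop (nhds 0) := by
    refine tendsto_zero_of_le_separation (hPcomp 0) (fun k => hanti k.zero_le (hvP k))
      (fun k => dotProduct_mulVec_nonneg (hMkpd k).posSemidef _) M' fun k j hkj => ?_
    have hcut : Mk k *ᵥ (y k - v k) ⬝ᵥ y k ≤ Mk k *ᵥ (y k - v k) ⬝ᵥ v j :=
      hc k (hanti hkj (hvP j))
    have hle := dotProduct_mulVec_le_of_halfspace (hMkpd k).posSemidef
      (u := y k - v k) (d := v j - v k) (by
        rw [dotProduct_sub, dotProduct_sub]
        linarith)
    rw [← neg_sub (y k), mulVec_neg, neg_dotProduct_neg]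
    exact hle.trans (dotProduct_mulVec_le (hup k) _)
  have hr : Filter.Tendsto (fun k => ENNReal.ofReal (mnorm (Mk k) (v k - y k) / √m))
      Filter.atTop (nhds 0) := by
    have := ENNReal.tendsto_ofReal (hsq.sqrt.div_const √m)
    simpa [mnorm] using this
  refine tendsto_of_tendsto_of_tendsto_of_le_of_le tendsto_const_nhds hr
    (fun _ => zero_le) fun k => hdistN_enorm2_le (hAP k) fun w hw => ?_
  obtain ⟨b, hb', hle⟩ := exists_mnorm_le_dM (Mk k) hAne hAcomp w
  refine ⟨b, hb', (enorm2_le_mnorm_div hm (hlow k) _).trans ?_⟩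
  gcongr
  rw [hb k, ha k]
  exact hle.trans (le_csSup (bddAbove_dM_image (Mk k) hAne (hPcomp k)) ⟨w, hw, rfl⟩)
end

section
/- Let q ≥ 2, let p, d ∈ ℝ^q with ‖d‖_2 = 1, let κ > 0 and θ ∈ (0, π/2). Let w_1, …, w_k ∈ ℝ^q be unit vectors with ⟨w_i, d⟩ ≤ cos θ for all i (i.e., the angle between each w_i and d is at least θ), let b_1, …, b_k ∈ ℝ, and suppose the closed Euclidean ball B̄(p − d/κ, 1/κ) is contained in each halfspace H_i := {y ∈ ℝ^q : ⟨w_i, y⟩ ≤ b_i}. Then for every t ∈ [0, (1/cos θ − 1)/κ], the point p + t d belongs to ∩_{i=1}^k H_i; consequently sup{⟨d, y⟩ : y ∈ ∩_{i=1}^k H_i} ≥ ⟨d, p⟩ + (1/κ)(1/cos θ − 1). In particular, if θ ≤ π/4, then 1/cos θ − 1 ≥ θ²/2, so the supremum is at least ⟨d, p⟩ + θ²/(2κ). -/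
open Metric Set Real
open scoped RealInnerProductSpace

/-- If a closed ball with center `c` and radius `r` lies in the halfspace `{y | ⟪w, y⟫ ≤ b}` with
unit normal `w`, then `⟪w, c⟫ + r ≤ b`. -/
theorem inner_center_add_radius_le {E : Type*} [NormedAddCommGroup E] [InnerProductSpace ℝ E]
    {c w : E} {r b : ℝ} (hr : 0 ≤ r) (hw : ‖w‖ = 1)
    (h : closedBall c r ⊆ {y | ⟪w, y⟫ ≤ b}) : ⟪w, c⟫ + r ≤ b := by
  have hmem : c + r • w ∈ closedBall c r := by
    simp [mem_closedBall, dist_eq_norm, norm_smul, hw, abs_of_nonneg hr]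
  have hle : ⟪w, c + r • w⟫ ≤ b := h hmem
  rwa [inner_add_right, real_inner_smul_right, real_inner_self_eq_norm_sq, hw, one_pow,
    mul_one] at hle

theorem half_sq_le_inv_cos_sub_one {x : ℝ} (hx : |x| ≤ 1) :
    x ^ 2 / 2 ≤ (Real.cos x)⁻¹ - 1 := by
  have hcos : 0 < Real.cos x := Real.cos_pos_of_le_one hx
  have hupper := (abs_le.mp (Real.cos_bound hx)).2
  have hpow : |x| ^ 4 = (x ^ 2) ^ 2 := by rw [← sq_abs x]; ring
  rw [hpow] at hupper
  have hsq : x ^ 2 ≤ 1 := (sq_le_one_iff_abs_le_one x).mpr hx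
  suffices hmul : (1 + x ^ 2 / 2) * Real.cos x ≤ 1 by
    have hinv : 1 + x ^ 2 / 2 ≤ (Real.cos x)⁻¹ := by
      rw [← one_div]
      exact (le_div_iff₀ hcos).mpr hmul
    linarith
  calc (1 + x ^ 2 / 2) * Real.cos x
      ≤ (1 + x ^ 2 / 2) * (1 - x ^ 2 / 2 + (x ^ 2) ^ 2 * (5 / 96)) := by
        gcongr
        linarith
    _ ≤ 1 := by nlinarith [mul_nonneg (sq_nonneg (x ^ 2)) (sub_nonneg.mpr hsq)]

/-- osculating-ball extent lower bound.  If the closed ball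
`B̄(p − d/κ, 1/κ)` is contained in every halfspace `H_i = {y : ⟪w_i, y⟫ ≤ b_i}` whose
unit normal `w_i` makes an angle at least `θ` with the unit vector `d`
(i.e. `⟪w_i, d⟫ ≤ cos θ`), then the segment `p + t d`, `0 ≤ t ≤ (1/cos θ − 1)/κ`,
lies in `∩_i H_i`; consequently `sup{⟪d,y⟫ : y ∈ ∩_i H_i} ≥ ⟪d,p⟫ + (1/κ)(1/cos θ − 1)`,
and if moreover `θ ≤ π/4` then `1/cos θ − 1 ≥ θ²/2`, so the supremum is at least
`⟪d,p⟫ + θ²/(2κ)`. -/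
theorem stmt19 {q : ℕ} (hq : 2 ≤ q)
    (p d : EuclideanSpace ℝ (Fin q)) (hd : ‖d‖ = 1)
    (κ : ℝ) (hκ : 0 < κ) (θ : ℝ) (hθ : θ ∈ Set.Ioo 0 (π / 2))
    {k : ℕ} (w : Fin k → EuclideanSpace ℝ (Fin q)) (hw : ∀ i, ‖w i‖ = 1)
    (hangle : ∀ i, ⟪w i, d⟫ ≤ Real.cos θ)
    (b : Fin k → ℝ)
    (H : Fin k → Set (EuclideanSpace ℝ (Fin q)))
    (hH : ∀ i, H i = {y | ⟪w i, y⟫ ≤ b i})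
    (hball : ∀ i, closedBall (p - κ⁻¹ • d) κ⁻¹ ⊆ H i) :
    (∀ t ∈ Set.Icc (0 : ℝ) (((Real.cos θ)⁻¹ - 1) / κ), p + t • d ∈ ⋂ i, H i) ∧
    (((⟪d, p⟫ + κ⁻¹ * ((Real.cos θ)⁻¹ - 1) : ℝ) : EReal)
        ≤ ⨆ y ∈ ⋂ i, H i, ((⟪d, y⟫ : ℝ) : EReal)) ∧
    (θ ≤ π / 4 →
      θ ^ 2 / 2 ≤ (Real.cos θ)⁻¹ - 1 ∧
      ((⟪d, p⟫ + θ ^ 2 / (2 * κ) : ℝ) : EReal)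
        ≤ ⨆ y ∈ ⋂ i, H i, ((⟪d, y⟫ : ℝ) : EReal)) := by
  have hcos : 0 < Real.cos θ := Real.cos_pos_of_mem_Ioo ⟨by linarith [hθ.1, pi_pos], hθ.2⟩
  have hinv : 1 ≤ (Real.cos θ)⁻¹ := (one_le_inv₀ hcos).mpr (Real.cos_le_one θ)
  have hsegment : ∀ t ∈ Set.Icc (0 : ℝ) (((Real.cos θ)⁻¹ - 1) / κ),
      p + t • d ∈ ⋂ i, H i := by
    rintro t ⟨ht0, ht⟩
    refine mem_iInter.mpr fun i => ?_
    have hsupport := inner_center_add_radius_le (inv_nonneg.mpr hκ.le) (hw i) (hH i ▸ hball i)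
    rw [inner_sub_right, real_inner_smul_right] at hsupport
    have hscale : (t + κ⁻¹) * ⟪w i, d⟫ ≤ κ⁻¹ :=
      calc (t + κ⁻¹) * ⟪w i, d⟫ ≤ (t + κ⁻¹) * Real.cos θ := by
            gcongr
            exact hangle i
        _ ≤ (((Real.cos θ)⁻¹ - 1) / κ + κ⁻¹) * Real.cos θ := by gcongr
        _ = κ⁻¹ := by field_simp; ring
    rw [hH i, mem_ofPred_eq, inner_add_right, real_inner_smul_right]
    linarith
  have hsup : ((⟪d, p⟫ + κ⁻¹ * ((Real.cos θ)⁻¹ - 1) : ℝ) : EReal)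
      ≤ ⨆ y ∈ ⋂ i, H i, ((⟪d, y⟫ : ℝ) : EReal) := by
    refine le_trans (le_of_eq ?_) (le_iSup₂ (f := fun y _ => ((⟪d, y⟫ : ℝ) : EReal)) _
      (hsegment _ (right_mem_Icc.mpr (div_nonneg (sub_nonneg.mpr hinv) hκ.le))))
    rw [inner_add_right, real_inner_smul_right, real_inner_self_eq_norm_sq, hd, one_pow, mul_one,
      div_eq_inv_mul]
  refine ⟨hsegment, hsup, fun hθ' => ?_⟩
  have hquad : θ ^ 2 / 2 ≤ (Real.cos θ)⁻¹ - 1 :=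
    half_sq_le_inv_cos_sub_one (abs_le.mpr ⟨by linarith [hθ.1], by linarith [pi_le_four]⟩)
  refine ⟨hquad, le_trans (EReal.coe_le_coe_iff.mpr ?_) hsup⟩
  calc ⟪d, p⟫ + θ ^ 2 / (2 * κ) = ⟪d, p⟫ + κ⁻¹ * (θ ^ 2 / 2) := by field_simp
    _ ≤ ⟪d, p⟫ + κ⁻¹ * ((Real.cos θ)⁻¹ - 1) := by gcongr
end
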